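/- Let μ be a finite nonnegative Borel measure on ℝ with Fourier transform μ̂. Suppose there exist constants C > 0, c > 0, δ > 0 and θ ∈ (1/2, 1] such that for every ξ with |ξ| ≥ 1 and every ε ∈ (0, 1/2): |μ̂(ξ)| ≤ exp(−c δ √ε ξ²/2) + C|ξ| ε^{(1+θ)/4} + C ε^{θ/4}. Then ∫_ℝ |μ̂(ξ)|² dξ < ∞, and consequently μ is absolutely continuous with respect to Lebesgue measure. -/

import Mathlib

open MeasureTheory

/-- The Fourier transform of a finite nonnegative Borel measure on `ℝ`:
`μ̂(ξ) = ∫ e^{iξx} μ(dx)`. -/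
noncomputable def fourierOfMeasure (μ : Measure ℝ) (ξ : ℝ) : ℂ :=
  ∫ x, Complex.exp (Complex.I * ξ * x) ∂μ

open Filter Asymptotics
open scoped SchwartzMap FourierTransform RealInnerProductSpace Manifold Real

theorem exists_schwartzMap_eq_one_of_isCompact {E : Type*} [NormedAddCommGroup E]
    [NormedSpace ℝ E] [FiniteDimensional ℝ E] {K U : Set E} (hK : IsCompact K)
    (hU : IsOpen U) (hKU : K ⊆ U) :
    ∃ f : 𝓢(E, ℝ), (∀ x, f x ∈ Set.Icc 0 1) ∧ (∀ x ∈ K, f x = 1) ∧ Function.support f ⊆ U := by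
  obtain ⟨L, hL, hKL, hLU⟩ := exists_compact_between hK hU hKU
  obtain ⟨f, f_smooth, f_range, f_supp, hf⟩ :=
    exists_contMDiff_support_eq_eq_one_iff 𝓘(ℝ, E) (n := ⊤) isOpen_interior hK.isClosed hKL
  have f_compact : HasCompactSupport f :=
    .of_support_subset_isCompact hL (f_supp.trans_subset interior_subset)
  exact ⟨f_compact.toSchwartzMap f_smooth.contDiff, fun x ↦ f_range ⟨x, rfl⟩,
    fun x hx ↦ (hf x).1 hx, f_supp.trans_subset (interior_subset.trans hLU)⟩

section FiniteDimensional

variable {E : Type*} [NormedAddCommGroup E] [InnerProductSpace ℝ E] [FiniteDimensional ℝ E]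
  [MeasurableSpace E] [BorelSpace E] {μ : Measure E}

theorem integral_schwartzMap_eq_integral_fourier_mul_charFun [IsFiniteMeasure μ] (f : 𝓢(E, ℂ)) :
    ∫ x, f x ∂μ = ∫ ξ, 𝓕 f ξ * charFun μ ((2 * π) • ξ) := by
  have inversion (x : E) : f x = ∫ ξ, Complex.exp (2 * π * ⟪ξ, x⟫ * Complex.I) * 𝓕 f ξ := by
    calc f x = (𝓕⁻ (𝓕 f)) x := by rw [FourierTransform.fourierInv_fourier_eq]
      _ = _ := by rw [SchwartzMap.fourierInv_coe, Real.fourierInv_eq']; simp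
  simp_rw [inversion]
  rw [integral_integral_swap]
  · refine integral_congr_ae (.of_forall fun ξ ↦ ?_)
    dsimp only
    rw [integral_mul_const, charFun_apply, mul_comm]
    congr 2 with x
    simp [inner_smul_right, real_inner_comm ξ x]
  · have hf : Integrable (fun p : E × E ↦ 𝓕 f p.2) (μ.prod volume) := (𝓕 f).integrable.comp_snd μ
    refine hf.bdd_mul (c := 1) (by fun_prop) (.of_forall fun p ↦ ?_)
    rw [Complex.norm_exp]
    simp

theorem norm_integral_schwartzMap_sq_le [IsFiniteMeasure μ]
    (hμ : Integrable fun ξ ↦ ‖charFun μ ξ‖ ^ 2) (f : 𝓢(E, ℂ)) :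
    ‖∫ x, f x ∂μ‖ ^ 2 ≤ (∫ x, ‖f x‖ ^ 2) * ∫ ξ, ‖charFun μ ((2 * π) • ξ)‖ ^ 2 := by
  have hint : Integrable fun ξ ↦ ‖charFun μ ((2 * π) • ξ)‖ ^ 2 :=
    hμ.comp_smul (R := 2 * π) (by positivity)
  have hg : MemLp (fun ξ ↦ charFun μ ((2 * π) • ξ)) 2 :=
    (memLp_two_iff_integrable_sq_norm
      (continuous_charFun.comp (continuous_const_smul _)).aestronglyMeasurable).2 hint
  have holder := integral_mul_norm_le_Lp_mul_Lq (μ := volume) (f := ⇑(𝓕 f : 𝓢(E, ℂ)))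
    (g := fun ξ ↦ charFun μ ((2 * π) • ξ)) Real.HolderConjugate.two_two
    (by simpa using (𝓕 f).memLp 2) (by simpa using hg)
  simp only [Real.rpow_ofNat, ← Real.sqrt_eq_rpow, f.integral_norm_sq_fourier] at holder
  have bound : ‖∫ x, f x ∂μ‖ ≤ √(∫ x, ‖f x‖ ^ 2) * √(∫ ξ, ‖charFun μ ((2 * π) • ξ)‖ ^ 2) := by
    rw [integral_schwartzMap_eq_integral_fourier_mul_charFun]
    refine (norm_integral_le_integral_norm _).trans ?_
    simpa only [norm_mul] using holder
  calc ‖∫ x, f x ∂μ‖ ^ 2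
      ≤ (√(∫ x, ‖f x‖ ^ 2) * √(∫ ξ, ‖charFun μ ((2 * π) • ξ)‖ ^ 2)) ^ 2 := by gcongr
    _ = _ := by
      rw [mul_pow, Real.sq_sqrt (by positivity), Real.sq_sqrt (by positivity)]

theorem measureReal_sq_le_of_isCompact [IsFiniteMeasure μ]
    (hμ : Integrable fun ξ ↦ ‖charFun μ ξ‖ ^ 2) {K U : Set E} (hK : IsCompact K) (hU : IsOpen U)
    (hKU : K ⊆ U) (hU_fin : volume U ≠ ⊤) :
    μ.real K ^ 2 ≤ volume.real U * ∫ ξ, ‖charFun μ ((2 * π) • ξ)‖ ^ 2 := by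
  obtain ⟨f, f_mem, f_one, f_supp⟩ := exists_schwartzMap_eq_one_of_isCompact hK hU hKU
  let F : 𝓢(E, ℂ) := SchwartzMap.postcompCLM Complex.ofRealCLM f
  have hF (x : E) : F x = (f x : ℂ) := rfl
  have lower : μ.real K ≤ ∫ x, f x ∂μ := by
    rw [← integral_indicator_one hK.measurableSet]
    refine integral_mono ((integrable_const 1).indicator hK.measurableSet) f.integrable fun x ↦ ?_
    by_cases hx : x ∈ K
    · simp [hx, f_one]
    · simpa [hx] using (f_mem x).1
  have upper : ∫ x, ‖F x‖ ^ 2 ≤ volume.real U := by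
    rw [← integral_indicator_one hU.measurableSet]
    refine integral_mono_of_nonneg (.of_forall fun x ↦ by positivity)
      ((integrable_indicator_iff hU.measurableSet).2 (integrableOn_const hU_fin))
      (.of_forall fun x ↦ ?_)
    by_cases hx : x ∈ U
    · simpa [hx, hF, abs_of_nonneg (f_mem x).1] using (f_mem x).2
    · have : f x = 0 := by_contra fun h ↦ hx (f_supp h)
      simp [hx, hF, this]
  calc μ.real K ^ 2 ≤ (∫ x, f x ∂μ) ^ 2 := by gcongr
    _ = ‖∫ x, F x ∂μ‖ ^ 2 := by simp [hF, integral_complex_ofReal]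
    _ ≤ (∫ x, ‖F x‖ ^ 2) * ∫ ξ, ‖charFun μ ((2 * π) • ξ)‖ ^ 2 :=
      norm_integral_schwartzMap_sq_le hμ F
    _ ≤ _ := by gcongr

/-- A finite measure with square-integrable characteristic function is absolutely continuous. -/
theorem absolutelyContinuous_of_integrable_sq_charFun [IsFiniteMeasure μ]
    (hμ : Integrable fun ξ ↦ ‖charFun μ ξ‖ ^ 2) : μ ≪ volume := by
  refine Measure.AbsolutelyContinuous.mk fun A hA hA_zero ↦ ?_
  rw [hA.measure_eq_iSup_isCompact μ]
  simp only [ENNReal.iSup_eq_zero]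
  intro K hKA hK
  have hK_zero : volume K = 0 := measure_mono_null hKA hA_zero
  set M := ∫ ξ, ‖charFun μ ((2 * π) • ξ)‖ ^ 2
  have hM : 0 ≤ M := by positivity
  have small : ∀ ε > 0, μ.real K ^ 2 ≤ 0 + ε := by
    intro ε hε
    obtain ⟨U, hKU, hU, hU_lt⟩ := K.exists_isOpen_lt_of_lt (μ := volume)
      (ENNReal.ofReal (ε / (M + 1))) (by rw [hK_zero]; exact ENNReal.ofReal_pos.2 (by positivity))
    have hU_real : volume.real U ≤ ε / (M + 1) :=
      ENNReal.toReal_le_of_le_ofReal (by positivity) hU_lt.le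
    calc μ.real K ^ 2 ≤ volume.real U * M :=
          measureReal_sq_le_of_isCompact hμ hK hU hKU hU_lt.ne_top
      _ ≤ ε / (M + 1) * (M + 1) := by gcongr; linarith
      _ = 0 + ε := by field_simp; ring
  have := le_of_forall_pos_le_add small
  rw [← measureReal_eq_zero_iff]
  exact pow_eq_zero_iff two_ne_zero |>.1 (this.antisymm (sq_nonneg _))

end FiniteDimensional

theorem fourierOfMeasure_eq_charFun (μ : Measure ℝ) : fourierOfMeasure μ = charFun μ := by
  ext ξ
  simp only [fourierOfMeasure, charFun_apply_real]
  congr with x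
  ring_nf

theorem isLittleO_exp_neg_mul_rpow_rpow_atTop {a p : ℝ} (ha : 0 < a) (hp : 0 < p) (b : ℝ) :
    (fun x : ℝ ↦ Real.exp (-a * x ^ p)) =o[atTop] fun x ↦ x ^ b := by
  have := (isLittleO_exp_neg_mul_rpow_atTop ha (b / p)).comp_tendsto (tendsto_rpow_atTop hp)
  refine this.congr' .rfl ?_
  filter_upwards [eventually_ge_atTop 0] with x hx
  simp only [Function.comp_apply]
  rw [← Real.rpow_mul hx, mul_div_cancel₀ _ hp.ne']

/-- Choosing `ε = x ^ (θ - 1 / 2 - 4)` turns the bounds into a polynomial decay of exponent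
strictly less than `-1 / 2`. -/
theorem isBigO_rpow_of_forall_le_exp_add_rpow {E : Type*} [Norm E] {f : ℝ → E} {a C θ : ℝ}
    (ha : 0 < a) (hC : 0 ≤ C) (hθ : θ ∈ Set.Ioc (1 / 2 : ℝ) 1)
    (h : ∀ x : ℝ, 1 ≤ x → ∀ ε ∈ Set.Ioo (0 : ℝ) (1 / 2),
      ‖f x‖ ≤ Real.exp (-a * (√ε * x ^ 2)) + C * x * ε ^ ((1 + θ) / 4) + C * ε ^ (θ / 4)) :
    f =O[atTop] fun x ↦ x ^ (-(θ / 2 + 1 / 4)) := by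
  obtain ⟨hθ₁, hθ₂⟩ := hθ
  have exp_bound := (isLittleO_exp_neg_mul_rpow_rpow_atTop ha (p := (θ - 1 / 2) / 2) (by linarith)
    (-(θ / 2 + 1 / 4))).isBigO
  refine IsBigO.trans (IsBigO.of_norm_eventuallyLE ?_)
    (exp_bound.add ((isBigO_refl (fun x : ℝ ↦ x ^ (-(θ / 2 + 1 / 4))) atTop).const_mul_left (2 * C)))
  filter_upwards [eventually_gt_atTop 2] with x hx
  have x_pos : 0 < x := by linarith
  have one_le_x : 1 ≤ x := by linarith
  have ε_lt : x ^ (θ - 1 / 2 - 4) < 1 / 2 := by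
    calc x ^ (θ - 1 / 2 - 4) ≤ x ^ (-1 : ℝ) :=
          Real.rpow_le_rpow_of_exponent_le one_le_x (by linarith)
      _ < 1 / 2 := by
        rw [Real.rpow_neg_one, one_div]
        exact inv_strictAnti₀ two_pos hx
  refine (h x one_le_x _ ⟨Real.rpow_pos_of_pos x_pos _, ε_lt⟩).trans ?_
  have gaussian : √(x ^ (θ - 1 / 2 - 4)) * x ^ 2 = x ^ ((θ - 1 / 2) / 2) := by
    rw [Real.sqrt_eq_rpow, ← Real.rpow_mul x_pos.le, ← Real.rpow_two, ← Real.rpow_add x_pos]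
    ring_nf
  have drift : x * (x ^ (θ - 1 / 2 - 4)) ^ ((1 + θ) / 4) ≤ x ^ (-(θ / 2 + 1 / 4)) := by
    nth_rw 1 [← Real.rpow_one x]
    rw [← Real.rpow_mul x_pos.le, ← Real.rpow_add x_pos]
    exact Real.rpow_le_rpow_of_exponent_le one_le_x (by nlinarith)
  have rest : (x ^ (θ - 1 / 2 - 4)) ^ (θ / 4) ≤ x ^ (-(θ / 2 + 1 / 4)) := by
    rw [← Real.rpow_mul x_pos.le]
    exact Real.rpow_le_rpow_of_exponent_le one_le_x (by nlinarith)
  rw [gaussian]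
  linarith [mul_le_mul_of_nonneg_left drift hC, mul_le_mul_of_nonneg_left rest hC]

theorem integrable_norm_sq_charFun_of_isBigO_rpow {μ : Measure ℝ} [IsFiniteMeasure μ] {s : ℝ}
    (hs : 1 / 2 < s) (h : charFun μ =O[atTop] fun x ↦ x ^ (-s)) :
    Integrable fun ξ ↦ ‖charFun μ ξ‖ ^ 2 := by
  have sq_bound : (fun ξ ↦ ‖charFun μ ξ‖ ^ 2) =O[atTop] fun x : ℝ ↦ x ^ (-s * 2) := by
    refine (h.norm_left.pow 2).congr' .rfl ?_
    filter_upwards [eventually_ge_atTop 0] with x hx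
    rw [← Real.rpow_mul_natCast hx, Nat.cast_ofNat]
  refine LocallyIntegrable.integrable_of_isBigO_atTop_of_norm_isNegInvariant
    (continuous_charFun.norm.pow 2).locallyIntegrable (.of_forall fun ξ ↦ ?_) sq_bound
    (integrableAtFilter_rpow_atTop_iff.2 (by linarith))
  simp [charFun_neg]

/-- If a finite nonnegative Borel measure `μ` on `ℝ` satisfies, for some constants `C > 0`,
`c > 0`, `δ > 0` and `θ ∈ (1/2, 1]`, the bound
`|μ̂(ξ)| ≤ exp(-c δ √ε ξ²/2) + C |ξ| ε^{(1+θ)/4} + C ε^{θ/4}`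
for every `|ξ| ≥ 1` and every `ε ∈ (0, 1/2)`, then `∫ |μ̂(ξ)|² dξ < ∞` and consequently
`μ` is absolutely continuous with respect to Lebesgue measure. -/
theorem integrable_sq_fourier_and_absolutelyContinuous_heat
    (μ : Measure ℝ) [IsFiniteMeasure μ] (C c δ θ : ℝ)
    (hC : 0 < C) (hc : 0 < c) (hδ : 0 < δ) (hθ : θ ∈ Set.Ioc (1 / 2 : ℝ) 1)
    (h : ∀ ξ : ℝ, 1 ≤ |ξ| → ∀ ε ∈ Set.Ioo (0 : ℝ) (1 / 2),
      ‖fourierOfMeasure μ ξ‖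
        ≤ Real.exp (-(c * δ * Real.sqrt ε * ξ ^ 2) / 2) + C * |ξ| * ε ^ ((1 + θ) / 4)
          + C * ε ^ (θ / 4)) :
    Integrable (fun ξ : ℝ => ‖fourierOfMeasure μ ξ‖ ^ 2) ∧ μ ≪ volume := by
  simp only [fourierOfMeasure_eq_charFun] at h ⊢
  have decay : charFun μ =O[atTop] fun x ↦ x ^ (-(θ / 2 + 1 / 4)) := by
    refine isBigO_rpow_of_forall_le_exp_add_rpow (a := c * δ / 2) (by positivity) hC.le hθ
      fun x hx ε hε ↦ ?_
    have x_abs : |x| = x := abs_of_pos (by linarith)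
    have := h x (by rwa [x_abs]) ε hε
    rw [x_abs] at this
    convert this using 4
    ring
  have hint := integrable_norm_sq_charFun_of_isBigO_rpow (by linarith [hθ.1]) decay
  exact ⟨hint, absolutelyContinuous_of_integrable_sq_charFun hint⟩
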